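/- arXiv:2009.04558 — 2 statements merged into one kernel-verified Lean document; each statement's English description precedes it below -/
import Mathlib

section
/- Let f : X → Y be a continuous map from a compact metric space X to a metric space Y, and let d ≥ 0 be an integer. Then for every y ∈ Y, UW_d(f⁻¹(y)) equals the infimum of UW_d(f⁻¹(V)) over all open neighborhoods V of y in Y. -/
/-- The Urysohn `d`-width of a subset `S` of a metric space `X`, defined as the
infimum, over all covers of `S` by open subsets of `X` of multiplicity at most
`d+1`, of the supremum of the diameters of the covering sets. -/
noncomputable def openWidth {X : Type*} [MetricSpace X] (d : ℕ) (S : Set X) : ℝ :=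
  sInf {w : ℝ | ∃ 𝒰 : Set (Set X),
    (∀ U ∈ 𝒰, IsOpen U) ∧ S ⊆ ⋃₀ 𝒰 ∧
    (∀ x : X, {U ∈ 𝒰 | x ∈ U}.Finite ∧ {U ∈ 𝒰 | x ∈ U}.ncard ≤ d + 1) ∧
    ∀ U ∈ 𝒰, Metric.diam U ≤ w}

theorem openWidth_empty {X : Type*} [MetricSpace X] (d : ℕ) :
    openWidth d (∅ : Set X) = 0 := by
  have h : {w : ℝ | ∃ 𝒰 : Set (Set X),
      (∀ U ∈ 𝒰, IsOpen U) ∧ (∅ : Set X) ⊆ ⋃₀ 𝒰 ∧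
      (∀ x : X, {U ∈ 𝒰 | x ∈ U}.Finite ∧ {U ∈ 𝒰 | x ∈ U}.ncard ≤ d + 1) ∧
      ∀ U ∈ 𝒰, Metric.diam U ≤ w} = Set.univ :=
    Set.eq_univ_of_forall fun w => ⟨∅, by simp⟩
  rw [openWidth, h, Real.sInf_univ]

theorem nonneg_of_cover_diam_le {X : Type*} [MetricSpace X] {S : Set X} (hS : S.Nonempty)
    {𝒰 : Set (Set X)} (hcov : S ⊆ ⋃₀ 𝒰) {w : ℝ} (hw : ∀ U ∈ 𝒰, Metric.diam U ≤ w) :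
    0 ≤ w := by
  obtain ⟨x, hx⟩ := hS
  obtain ⟨U, hU, -⟩ := hcov hx
  exact Metric.diam_nonneg.trans (hw U hU)

theorem openWidth_nonneg {X : Type*} [MetricSpace X] (d : ℕ) (S : Set X) :
    0 ≤ openWidth d S := by
  rcases S.eq_empty_or_nonempty with rfl | hS
  · exact (openWidth_empty d).ge
  · exact Real.sInf_nonneg fun w ⟨_, _, hcov, _, hw⟩ => nonneg_of_cover_diam_le hS hcov hw

theorem openWidth_le {X : Type*} [MetricSpace X] {d : ℕ} {S : Set X} (hS : S.Nonempty)
    {𝒰 : Set (Set X)} (hopen : ∀ U ∈ 𝒰, IsOpen U) (hcov : S ⊆ ⋃₀ 𝒰)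
    (hmult : ∀ x : X, {U ∈ 𝒰 | x ∈ U}.Finite ∧ {U ∈ 𝒰 | x ∈ U}.ncard ≤ d + 1)
    {w : ℝ} (hw : ∀ U ∈ 𝒰, Metric.diam U ≤ w) : openWidth d S ≤ w :=
  csInf_le ⟨0, fun _ ⟨_, _, hcov', _, hw'⟩ => nonneg_of_cover_diam_le hS hcov' hw'⟩
    ⟨𝒰, hopen, hcov, hmult, hw⟩

theorem le_openWidth {X : Type*} [MetricSpace X] {d : ℕ} {S : Set X} {a : ℝ}
    (h : ∀ (w : ℝ) (𝒰 : Set (Set X)), (∀ U ∈ 𝒰, IsOpen U) → S ⊆ ⋃₀ 𝒰 →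
      (∀ x : X, {U ∈ 𝒰 | x ∈ U}.Finite ∧ {U ∈ 𝒰 | x ∈ U}.ncard ≤ d + 1) →
      (∀ U ∈ 𝒰, Metric.diam U ≤ w) → a ≤ w) : a ≤ openWidth d S := by
  refine le_csInf ⟨Metric.diam (Set.univ : Set X), {Set.univ}, by simp, by simp, fun x => ?_,
    by simp⟩ fun w ⟨𝒰, h₁, h₂, h₃, h₄⟩ => h w 𝒰 h₁ h₂ h₃ h₄
  have hsub : {U ∈ ({Set.univ} : Set (Set X)) | x ∈ U} ⊆ {Set.univ} := Set.sep_subset _ _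
  refine ⟨(Set.finite_singleton _).subset hsub, (Set.ncard_le_ncard hsub).trans ?_⟩
  simp

theorem openWidth_mono {X : Type*} [MetricSpace X] (d : ℕ) {S T : Set X} (hST : S ⊆ T) :
    openWidth d S ≤ openWidth d T := by
  rcases S.eq_empty_or_nonempty with rfl | hS
  · exact (openWidth_empty d).trans_le (openWidth_nonneg d T)
  · exact le_openWidth fun w 𝒰 hopen hcov hmult hw =>
      openWidth_le hS hopen (hST.trans hcov) hmult hw

theorem IsClosedMap.exists_isOpen_preimage_subset {X Y : Type*} [TopologicalSpace X]
    [TopologicalSpace Y] {f : X → Y} (hf : IsClosedMap f) {y : Y} {W : Set X}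
    (hW : IsOpen W) (hyW : f ⁻¹' {y} ⊆ W) :
    ∃ V : Set Y, IsOpen V ∧ y ∈ V ∧ f ⁻¹' V ⊆ W := by
  refine ⟨(f '' Wᶜ)ᶜ, (hf _ hW.isClosed_compl).isOpen_compl, ?_, fun x hx => ?_⟩
  · rintro ⟨x, hx, hxy⟩
    exact hx (hyW hxy)
  · by_contra hxW
    exact hx ⟨x, hxW, rfl⟩

/-- For a continuous map `f : X → Y` from a compact metric space to a metric
space and any `y : Y`, the Urysohn `d`-width of the fiber `f⁻¹ y` equals the
infimum of the Urysohn `d`-widths of the preimages `f⁻¹ V` over all open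
neighborhoods `V` of `y`. -/
theorem urysohnWidth_fiber_eq_iInf_nhds {X Y : Type*} [MetricSpace X]
    [CompactSpace X] [MetricSpace Y] (f : X → Y) (hf : Continuous f) (d : ℕ)
    (y : Y) :
    openWidth d (f ⁻¹' {y}) =
      sInf {w : ℝ | ∃ V : Set Y, IsOpen V ∧ y ∈ V ∧ w = openWidth d (f ⁻¹' V)} := by
  have hbdd : BddBelow {w : ℝ | ∃ V : Set Y, IsOpen V ∧ y ∈ V ∧ w = openWidth d (f ⁻¹' V)} := by
    refine ⟨0, ?_⟩
    rintro _ ⟨V, -, -, rfl⟩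
    exact openWidth_nonneg d _
  apply le_antisymm
  · refine le_csInf ⟨_, Set.univ, isOpen_univ, Set.mem_univ y, rfl⟩ ?_
    rintro _ ⟨V, -, hyV, rfl⟩
    exact openWidth_mono d (Set.preimage_mono (Set.singleton_subset_iff.2 hyV))
  · rcases (f ⁻¹' {y}).eq_empty_or_nonempty with hS | hS
    · obtain ⟨V, hV, hyV, hVW⟩ :=
        hf.isClosedMap.exists_isOpen_preimage_subset isOpen_empty hS.subset
      refine csInf_le hbdd ⟨V, hV, hyV, ?_⟩
      rw [hS, Set.subset_empty_iff.1 hVW]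
    · refine le_openWidth fun w 𝒰 hopen hcov hmult hw => ?_
      obtain ⟨V, hV, hyV, hVW⟩ :=
        hf.isClosedMap.exists_isOpen_preimage_subset (isOpen_sUnion hopen) hcov
      have hVne : (f ⁻¹' V).Nonempty :=
        hS.mono (Set.preimage_mono (Set.singleton_subset_iff.2 hyV))
      exact (csInf_le hbdd ⟨V, hV, hyV, rfl⟩).trans (openWidth_le hVne hopen hVW hmult hw)
end

section
/- Let X be a compact metric space and m, d ≥ 0 integers, and let u > 0. Suppose X admits a finite cover by open sets U_1, …, U_N such that every point of X lies in at most m+1 of the sets U_i, and UW_d(U_i) < u for every i. Then UW_{n-1}(X) < u, where n = (m+1)(d+1). -/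
/-- The set whose infimum is `openWidth d S` is nonempty when `S` is open:
`{S}` is an admissible cover. -/
theorem openWidth_set_nonempty {X : Type*} [MetricSpace X] (d : ℕ) {S : Set X} (hS : IsOpen S) :
    {w : ℝ | ∃ 𝒰 : Set (Set X), (∀ U ∈ 𝒰, IsOpen U) ∧ S ⊆ ⋃₀ 𝒰 ∧
      (∀ x : X, {U ∈ 𝒰 | x ∈ U}.Finite ∧ {U ∈ 𝒰 | x ∈ U}.ncard ≤ d + 1) ∧
      ∀ U ∈ 𝒰, Metric.diam U ≤ w}.Nonempty := by
  refine ⟨Metric.diam S, {S}, by simpa using hS, by simp, fun x => ?_, by simp⟩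
  have hsub : {U ∈ ({S} : Set (Set X)) | x ∈ U} ⊆ {S} := Set.sep_subset _ _
  refine ⟨(Set.finite_singleton S).subset hsub, ?_⟩
  have := Set.ncard_le_ncard hsub
  rw [Set.ncard_singleton] at this
  omega

/-- Over a nonempty space, an admissible cover of the whole space bounds its width. -/
theorem openWidth_le_of_cover {X : Type*} [MetricSpace X] [Nonempty X] {d : ℕ} {w : ℝ}
    {𝒰 : Set (Set X)} (hopen : ∀ U ∈ 𝒰, IsOpen U) (hcover : Set.univ ⊆ ⋃₀ 𝒰)
    (hmult : ∀ x : X, {U ∈ 𝒰 | x ∈ U}.Finite ∧ {U ∈ 𝒰 | x ∈ U}.ncard ≤ d + 1)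
    (hdiam : ∀ U ∈ 𝒰, Metric.diam U ≤ w) :
    openWidth d (Set.univ : Set X) ≤ w := by
  refine csInf_le ⟨0, ?_⟩ ⟨𝒰, hopen, hcover, hmult, hdiam⟩
  rintro v ⟨𝒱, -, h𝒱cover, -, h𝒱diam⟩
  obtain ⟨x⟩ := ‹Nonempty X›
  obtain ⟨A, hA, -⟩ := h𝒱cover (Set.mem_univ x)
  exact Metric.diam_nonneg.trans (h𝒱diam A hA)

/-- If a compact metric space `X` has a finite open cover `U₁, …, U_N` of
multiplicity at most `m+1` with `UW_d (Uᵢ) < u` for every `i`, then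
`UW_{n-1} (X) < u`, where `n = (m+1)(d+1)`. -/
theorem urysohnWidth_lt_of_cover {X : Type*} [MetricSpace X] [CompactSpace X]
    (m d : ℕ) (u : ℝ) (hu : 0 < u) (N : ℕ) (U : Fin N → Set X)
    (hopen : ∀ i, IsOpen (U i))
    (hcover : (⋃ i, U i) = Set.univ)
    (hmult : ∀ x : X, {i | x ∈ U i}.ncard ≤ m + 1)
    (hw : ∀ i, openWidth d (U i) < u) :
    openWidth ((m + 1) * (d + 1) - 1) (Set.univ : Set X) < u := by
  classical
  have hcov : ∀ i, ∃ w < u, ∃ 𝒰 : Set (Set X), (∀ A ∈ 𝒰, IsOpen A) ∧ U i ⊆ ⋃₀ 𝒰 ∧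
      (∀ x : X, {A ∈ 𝒰 | x ∈ A}.Finite ∧ {A ∈ 𝒰 | x ∈ A}.ncard ≤ d + 1) ∧
      ∀ A ∈ 𝒰, Metric.diam A ≤ w := fun i => by
    obtain ⟨w, h𝒰, hwu⟩ := exists_lt_of_csInf_lt (openWidth_set_nonempty d (hopen i)) (hw i)
    exact ⟨w, hwu, h𝒰⟩
  choose w hwu 𝒰 h𝒰open h𝒰cover h𝒰mult h𝒰diam using hcov
  obtain ⟨W, hwW, hWu⟩ : ∃ W, (∀ i, w i ≤ W) ∧ W < u :=
    ((Filter.eventually_all.2 fun i => Filter.Eventually.filter_mono nhdsWithin_le_nhds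
      (eventually_ge_nhds (hwu i))).and (self_mem_nhdsWithin (a := u) (s := Set.Iio u))).exists
  rcases isEmpty_or_nonempty X with hX | hX
  · have hall : openWidth ((m + 1) * (d + 1) - 1) (Set.univ : Set X) = sInf Set.univ := by
      unfold openWidth
      congr 1
      exact Set.eq_univ_of_forall fun _ =>
        ⟨∅, by simp, fun x _ => hX.elim x, fun x => hX.elim x, by simp⟩
    rwa [hall, Real.sInf_univ]
  refine (openWidth_le_of_cover (𝒰 := ⋃ i, (· ∩ U i) '' 𝒰 i) ?_ ?_ ?_ ?_).trans_lt hWu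
  · simp only [Set.mem_iUnion, Set.mem_image]
    rintro _ ⟨i, A, hA, rfl⟩
    exact (h𝒰open i A hA).inter (hopen i)
  · intro x _
    obtain ⟨i, hi⟩ := Set.mem_iUnion.1 (hcover ▸ Set.mem_univ x)
    obtain ⟨A, hA, hxA⟩ := h𝒰cover i hi
    exact ⟨A ∩ U i, Set.mem_iUnion.2 ⟨i, A, hA, rfl⟩, hxA, hi⟩
  · intro x
    let s : Finset (Set X) := (Finset.univ.filter fun i => x ∈ U i).biUnion
      fun i => (h𝒰mult i x).1.toFinset.image (· ∩ U i)
    have hsub : {V ∈ ⋃ i, (· ∩ U i) '' 𝒰 i | x ∈ V} ⊆ (s : Set (Set X)) := by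
      rintro V ⟨hV, hxV⟩
      obtain ⟨i, A, hA, rfl⟩ := Set.mem_iUnion.1 hV
      simp only [s, Finset.mem_coe, Finset.mem_biUnion, Finset.mem_filter, Finset.mem_univ,
        true_and, Finset.mem_image, Set.Finite.mem_toFinset]
      exact ⟨i, hxV.2, A, ⟨hA, hxV.1⟩, rfl⟩
    have hcard : s.card ≤ (m + 1) * (d + 1) := by
      refine (Finset.card_biUnion_le_card_mul _ _ (d + 1) fun i _ => ?_).trans
        (Nat.mul_le_mul_right _ ?_)
      · refine Finset.card_image_le.trans ?_
        rw [← Set.ncard_eq_toFinset_card _ (h𝒰mult i x).1]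
        exact (h𝒰mult i x).2
      · rw [← Set.ncard_coe_finset]
        simpa using hmult x
    refine ⟨s.finite_toSet.subset hsub, ?_⟩
    rw [Nat.sub_add_cancel (Nat.mul_pos m.succ_pos d.succ_pos)]
    refine (Set.ncard_le_ncard hsub s.finite_toSet).trans ?_
    rwa [Set.ncard_coe_finset]
  · simp only [Set.mem_iUnion, Set.mem_image]
    rintro _ ⟨i, A, hA, rfl⟩
    exact (Metric.diam_mono Set.inter_subset_left (Metric.isBounded_of_compactSpace)).trans
      ((h𝒰diam i A hA).trans (hwW i))
end
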